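/- arXiv:2209.13095 — 3 statements merged into one kernel-verified Lean document; each statement's English description precedes it below -/
import Mathlib

section
/- Let n ≥ 1, d ≥ 1, and let f_1,…,f_n : ℝ^d → ℝ be convex functions. Suppose the n-agent network is k-redundant for some 0 ≤ k ≤ n−1, and that argmin_x Σ_{i∈S} f_i(x) is nonempty for every subset S ⊆ {1,…,n} with |S| = n−k. Then for every subset S ⊆ {1,…,n} with |S| ≥ n−k, argmin_x Σ_{i∈S} f_i(x) = X*, where X* := argmin_x Σ_{i=1}^n f_i(x). -/
/-- The set of minimizers of `g` over `ℝ^d`. -/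
def argminSet {d : ℕ} (g : EuclideanSpace ℝ (Fin d) → ℝ) : Set (EuclideanSpace ℝ (Fin d)) :=
  {x | ∀ y, g x ≤ g y}

/-- An `n`-agent network with objectives `f` is `k`-redundant if any two subsets of agents of
cardinality `n - k` have the same set of minimizers of the sum of their objectives. -/
def Redundant (n d k : ℕ) (f : Fin n → EuclideanSpace ℝ (Fin d) → ℝ) : Prop :=
  ∀ S₁ S₂ : Finset (Fin n), S₁.card = n - k → S₂.card = n - k →
    argminSet (fun x => ∑ i ∈ S₁, f i x) = argminSet (fun x => ∑ i ∈ S₂, f i x)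

theorem sum_sum_erase_eq {ι : Type*} [DecidableEq ι] (S : Finset ι) (a : ι → ℝ) :
    ∑ i ∈ S, ∑ j ∈ S.erase i, a j = ((S.card : ℝ) - 1) * ∑ j ∈ S, a j := by
  have h : ∀ i ∈ S, ∑ j ∈ S.erase i, a j = ∑ j ∈ S, a j - a i := fun i hi => by
    rw [← Finset.add_sum_erase S a hi]
    ring
  rw [Finset.sum_congr rfl h, Finset.sum_sub_distrib, Finset.sum_const, nsmul_eq_mul]
  ring

/-- If removing any one agent from `S` leaves a sum whose set of minimizers is a fixed nonempty
set `A`, then `A` is also the set of minimizers of the sum over `S`. -/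
theorem argminSet_sum_eq_of_erase {ι : Type*} [DecidableEq ι] {d : ℕ}
    (f : ι → EuclideanSpace ℝ (Fin d) → ℝ) {A : Set (EuclideanSpace ℝ (Fin d))}
    (hA : A.Nonempty) {S : Finset ι} (hS : 1 < S.card)
    (h : ∀ i ∈ S, argminSet (fun x => ∑ j ∈ S.erase i, f j x) = A) :
    argminSet (fun x => ∑ j ∈ S, f j x) = A := by
  have hpos : (0 : ℝ) < (S.card : ℝ) - 1 := sub_pos.2 (by exact_mod_cast hS)
  have hmin : ∀ x ∈ A, ∀ i ∈ S, ∀ y,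
      ∑ j ∈ S.erase i, f j x ≤ ∑ j ∈ S.erase i, f j y := fun x hx i hi => by
    rw [← h i hi] at hx
    exact hx
  apply Set.Subset.antisymm
  · intro y hy
    obtain ⟨x, hx⟩ := hA
    have hle : ∑ i ∈ S, ∑ j ∈ S.erase i, f j y ≤ ∑ i ∈ S, ∑ j ∈ S.erase i, f j x := by
      rw [sum_sum_erase_eq S fun j => f j y, sum_sum_erase_eq S fun j => f j x]
      exact mul_le_mul_of_nonneg_left (hy x) hpos.le
    have heq := (Finset.sum_eq_sum_iff_of_le fun i hi => hmin x hx i hi y).1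
      (le_antisymm (Finset.sum_le_sum fun i hi => hmin x hx i hi y) hle)
    obtain ⟨i, hi⟩ := Finset.card_pos.1 (zero_lt_one.trans hS)
    rw [← h i hi]
    exact fun z => (heq i hi).symm.le.trans (hmin x hx i hi z)
  · intro x hx y
    have hle := Finset.sum_le_sum fun i hi => hmin x hx i hi y
    rw [sum_sum_erase_eq S fun j => f j y, sum_sum_erase_eq S fun j => f j x] at hle
    exact le_of_mul_le_mul_left hle hpos

/-- A nonempty set of minimizers common to all subsets of `m ≥ 1` agents is the set of minimizers
for every larger subset. -/
theorem argminSet_sum_eq_of_le_card {ι : Type*} {d m : ℕ} (hm : 1 ≤ m)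
    (f : ι → EuclideanSpace ℝ (Fin d) → ℝ) {A : Set (EuclideanSpace ℝ (Fin d))}
    (hA : A.Nonempty)
    (h : ∀ T : Finset ι, T.card = m → argminSet (fun x => ∑ i ∈ T, f i x) = A)
    (S : Finset ι) (hS : m ≤ S.card) : argminSet (fun x => ∑ i ∈ S, f i x) = A := by
  classical
  induction S using Finset.strongInduction with
  | H S ih =>
    rcases hS.eq_or_lt with heq | hlt
    · exact h S heq.symm
    · refine argminSet_sum_eq_of_erase f hA (hm.trans_lt hlt) fun i hi => ?_
      refine ih _ (Finset.erase_ssubset hi) ?_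
      rw [Finset.card_erase_of_mem hi]
      omega

theorem stmt1 (n d k : ℕ) (hn : 1 ≤ n) (hd : 1 ≤ d) (hk : k ≤ n - 1)
    (f : Fin n → EuclideanSpace ℝ (Fin d) → ℝ)
    (hconv : ∀ i, ConvexOn ℝ Set.univ (f i))
    (hred : Redundant n d k f)
    (hne : ∀ S : Finset (Fin n), S.card = n - k →
      (argminSet (fun x => ∑ i ∈ S, f i x)).Nonempty)
    (S : Finset (Fin n)) (hS : n - k ≤ S.card) :
    argminSet (fun x => ∑ i ∈ S, f i x) =
      argminSet (fun x => ∑ i : Fin n, f i x) := by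
  obtain ⟨T, -, hT⟩ := Finset.exists_subset_card_eq hS
  have key := argminSet_sum_eq_of_le_card (by omega) f (hne T hT) fun T' hT' => hred T' T hT' hT
  rw [key S hS, key Finset.univ (by simp)]
end

section
/- Consider the dynamics described in the context, with H ≥ 1 agents, states x_i(t) ∈ ℝ^d, row-stochastic matrices W(t), absolute probability sequence π(t), geometric ergodicity constant λ ∈ (0,1), disturbance bound D ≥ 0, and stepsizes α(t) that are positive, non-increasing, with Σ_t α(t) = ∞ and Σ_t α(t)² < ∞. Then the agents asymptotically reach a consensus: for all agents i and j, ‖x_i(t) − x_j(t)‖ → 0 as t → ∞. -/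
open Filter

/-- `backProd H W τ m = W (τ + m) * ⋯ * W (τ + 1) * W τ`, the backward product
`[W(t) W(t-1) ⋯ W(τ)]` with `t = τ + m`. -/
def backProd (H : ℕ) (W : ℕ → Matrix (Fin H) (Fin H) ℝ) (τ : ℕ) :
    ℕ → Matrix (Fin H) (Fin H) ℝ
  | 0 => W τ
  | m + 1 => W (τ + m + 1) * backProd H W τ m

theorem backProd_row_sum {H : ℕ} {W : ℕ → Matrix (Fin H) (Fin H) ℝ}
    (hWrow : ∀ t i, ∑ j, W t i j = 1) (τ m : ℕ) (i : Fin H) :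
    ∑ j, backProd H W τ m i j = 1 := by
  induction m generalizing i with
  | zero => exact hWrow τ i
  | succ m ih =>
    simp only [backProd, Matrix.mul_apply]
    rw [Finset.sum_comm]
    simp [← Finset.mul_sum, ih, hWrow]

/-- A nonnegative sequence that is halved every `M` steps, up to a vanishing error, vanishes. -/
theorem tendsto_zero_of_le_half_add {a b : ℕ → ℝ} {M : ℕ} (hM : 0 < M) (ha : ∀ n, 0 ≤ a n)
    (hb : Tendsto b atTop (nhds 0)) (h : ∀ n, a (n + M) ≤ a n / 2 + b n) :
    Tendsto a atTop (nhds 0) := by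
  obtain ⟨B, hB⟩ := hb.bddAbove_range
  have hB' : ∀ n, b n ≤ B := fun n => hB ⟨n, rfl⟩
  have hbound : ∃ C, ∀ n, a n ≤ C := by
    refine ⟨∑ k ∈ Finset.range M, a k + 2 * |B|, fun n => ?_⟩
    have hS : 0 ≤ ∑ k ∈ Finset.range M, a k := Finset.sum_nonneg fun k _ => ha k
    induction n using Nat.strong_induction_on with
    | _ n ih =>
      rcases lt_or_ge n M with hn | hn
      · have := Finset.single_le_sum (fun k _ => ha k) (Finset.mem_range.2 hn)
        linarith [abs_nonneg B]
      · obtain ⟨k, rfl⟩ := Nat.exists_eq_add_of_le' hn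
        linarith [h k, ih k (by omega), hB' k, le_abs_self B]
  obtain ⟨C, hC⟩ := hbound
  have key : ∀ ε > 0, ∀ k : ℕ, ∀ᶠ n in atTop, a n ≤ C * (1 / 2) ^ k + 2 * ε := by
    intro ε hε k
    induction k with
    | zero => exact Eventually.of_forall fun n => by linarith [hC n]
    | succ k ih =>
      obtain ⟨N, hN⟩ := eventually_atTop.1 (ih.and (hb.eventually_le_const hε))
      refine eventually_atTop.2 ⟨N + M, fun n hn => ?_⟩
      obtain ⟨l, rfl⟩ := Nat.exists_eq_add_of_le' (le_of_add_le_right hn)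
      obtain ⟨h1, h2⟩ := hN l (by omega)
      rw [pow_succ]
      linarith [h l]
  have hgeo : Tendsto (fun k : ℕ => C * (1 / 2 : ℝ) ^ k) atTop (nhds 0) := by
    simpa using (tendsto_pow_atTop_nhds_zero_of_lt_one
      (by norm_num : (0 : ℝ) ≤ 1 / 2) (by norm_num)).const_mul C
  refine tendsto_order.2 ⟨fun c hc => Eventually.of_forall fun n => hc.trans_le (ha n),
    fun c hc => ?_⟩
  obtain ⟨k, hk⟩ := (hgeo.eventually_lt_const (half_pos hc)).exists
  filter_upwards [key (c / 4) (by linarith) k] with n hn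
  linarith

/-- The error of propagating the states over `m + 1` steps by the backward product alone. -/
theorem norm_sub_backProd_smul_le {E : Type*} [NormedAddCommGroup E] [NormedSpace ℝ E] {H : ℕ}
    {D : ℝ} {W : ℕ → Matrix (Fin H) (Fin H) ℝ} {x u : ℕ → Fin H → E} {α : ℕ → ℝ}
    (hWnonneg : ∀ t i j, 0 ≤ W t i j) (hWrow : ∀ t i, ∑ j, W t i j = 1)
    (hu : ∀ t i, ‖u t i‖ ≤ D)
    (hdyn : ∀ t i, x (t + 1) i = (∑ j, W t i j • x t j) - α t • u t i)
    (hα : ∀ t, 0 ≤ α t) (hαmono : Antitone α) (τ m : ℕ) (i : Fin H) :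
    ‖x (τ + m + 1) i - ∑ j, backProd H W τ m i j • x τ j‖ ≤ (m + 1) * (α τ * D) := by
  have hstep : ∀ k i, ‖α (τ + k) • u (τ + k) i‖ ≤ α τ * D := fun k i => by
    rw [norm_smul, Real.norm_of_nonneg (hα _)]
    exact mul_le_mul (hαmono (Nat.le_add_right τ k)) (hu _ i) (norm_nonneg _) (hα τ)
  induction m generalizing i with
  | zero =>
    rw [Nat.add_zero, hdyn, backProd, sub_sub_cancel_left, norm_neg]
    simpa using hstep 0 i
  | succ m ih =>
    have hsplit : x (τ + (m + 1) + 1) i - ∑ j, backProd H W τ (m + 1) i j • x τ j =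
        ∑ l, W (τ + m + 1) i l •
            (x (τ + m + 1) l - ∑ j, backProd H W τ m l j • x τ j)
          - α (τ + (m + 1)) • u (τ + (m + 1)) i := by
      rw [hdyn]
      simp only [backProd, Matrix.mul_apply, Finset.sum_smul, smul_sub, Finset.smul_sum,
        Finset.sum_sub_distrib, mul_smul, ← add_assoc]
      rw [Finset.sum_comm]
      abel
    have hmix : ‖∑ l, W (τ + m + 1) i l •
        (x (τ + m + 1) l - ∑ j, backProd H W τ m l j • x τ j)‖ ≤ (m + 1) * (α τ * D) :=
      calc _ ≤ ∑ l, W (τ + m + 1) i l * ((m + 1) * (α τ * D)) := by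
            refine norm_sum_le_of_le _ fun l _ => ?_
            rw [norm_smul, Real.norm_of_nonneg (hWnonneg _ _ _)]
            exact mul_le_mul_of_nonneg_left (ih l) (hWnonneg _ _ _)
        _ = _ := by rw [← Finset.sum_mul, hWrow, one_mul]
    rw [hsplit]
    refine (norm_sub_le _ _).trans ?_
    push_cast
    linarith [hstep (m + 1) i]

/-- Two weighted sums with equal total weight and weights that are `c`-close to each other differ
by at most `c` times the spread of the vectors around any one point. -/
theorem norm_sum_smul_sub_sum_smul_le {ι E : Type*} [Fintype ι] [NormedAddCommGroup E]
    [NormedSpace ℝ E] {p q : ι → ℝ} {c : ℝ} (hsum : ∑ k, p k = ∑ k, q k)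
    (hpq : ∀ k, |p k - q k| ≤ c) (y : ι → E) (z : E) :
    ‖∑ k, p k • y k - ∑ k, q k • y k‖ ≤ c * ∑ k, ‖y k - z‖ := by
  have hcenter : ∑ k, p k • y k - ∑ k, q k • y k = ∑ k, (p k - q k) • (y k - z) := by
    simp only [smul_sub, sub_smul, Finset.sum_sub_distrib, ← Finset.sum_smul, hsum]
    abel
  rw [hcenter, Finset.mul_sum]
  refine norm_sum_le_of_le _ fun k _ => ?_
  rw [norm_smul, Real.norm_eq_abs]
  exact mul_le_mul_of_nonneg_right (hpq k) (norm_nonneg _)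

theorem stmt12 (H d : ℕ) (hH : 1 ≤ H) (hd : 1 ≤ d) (D : ℝ) (hD : 0 ≤ D)
    (lam : ℝ) (hlam0 : 0 < lam) (hlam1 : lam < 1)
    (W : ℕ → Matrix (Fin H) (Fin H) ℝ)
    (x u : ℕ → Fin H → EuclideanSpace ℝ (Fin d))
    (pivec : ℕ → Fin H → ℝ) (α : ℕ → ℝ)
    (hWnonneg : ∀ t i j, 0 ≤ W t i j)
    (hWrow : ∀ t i, ∑ j, W t i j = 1)
    (hu : ∀ t i, ‖u t i‖ ≤ D)
    (hdyn : ∀ t i, x (t + 1) i = (∑ j, W t i j • x t j) - α t • u t i)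
    (hpinonneg : ∀ t i, 0 ≤ pivec t i)
    (hpisum : ∀ t, ∑ i, pivec t i = 1)
    (hpiaps : ∀ t j, pivec t j = ∑ i, pivec (t + 1) i * W t i j)
    (hPhi : ∀ τ m i j, |backProd H W τ m i j - pivec τ j| ≤ 2 * lam ^ m)
    (hαpos : ∀ t, 0 < α t) (hαmono : ∀ t, α (t + 1) ≤ α t)
    (hαdiv : ¬ Summable α) (hαsq : Summable fun t => (α t) ^ 2) :
    ∀ i j, Tendsto (fun t => ‖x t i - x t j‖) atTop (nhds 0) := by
  intro i j
  have hαzero : Tendsto α atTop (nhds 0) := by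
    have h := hαsq.tendsto_atTop_zero.sqrt
    simpa [Real.sqrt_sq (hαpos _).le] using h
  obtain ⟨m, hm⟩ : ∃ m : ℕ, H * (4 * lam ^ m) < 1 / 2 := by
    have h := ((tendsto_pow_atTop_nhds_zero_of_lt_one hlam0.le hlam1).const_mul 4).const_mul (H : ℝ)
    rw [mul_zero, mul_zero] at h
    exact (h.eventually_lt_const (by norm_num)).exists
  have hpair : ∀ τ k, ‖x (τ + m + 1) k - x (τ + m + 1) i‖ ≤
      4 * lam ^ m * ∑ l, ‖x τ l - x τ i‖ + 2 * ((m + 1) * (α τ * D)) := by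
    intro τ k
    have herr := norm_sub_backProd_smul_le hWnonneg hWrow hu hdyn (fun t => (hαpos t).le)
      (antitone_nat_of_succ_le hαmono) τ m
    have hmain := norm_sum_smul_sub_sum_smul_le (p := backProd H W τ m k)
      (q := backProd H W τ m i) (c := 4 * lam ^ m)
      (by rw [backProd_row_sum hWrow, backProd_row_sum hWrow])
      (fun l => by
        have h := abs_sub_le (backProd H W τ m k l) (pivec τ l) (backProd H W τ m i l)
        rw [abs_sub_comm (pivec τ l)] at h
        linarith [hPhi τ m k l, hPhi τ m i l]) (x τ) (x τ i)
    have htri := norm_add₃_le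
      (a := x (τ + m + 1) k - ∑ l, backProd H W τ m k l • x τ l)
      (b := ∑ l, backProd H W τ m k l • x τ l - ∑ l, backProd H W τ m i l • x τ l)
      (c := ∑ l, backProd H W τ m i l • x τ l - x (τ + m + 1) i)
    rw [sub_add_sub_cancel, sub_add_sub_cancel] at htri
    have herr_i := herr i
    rw [norm_sub_rev] at herr_i
    linarith [herr k]
  have hspread : Tendsto (fun t => ∑ k, ‖x t k - x t i‖) atTop (nhds 0) := by
    refine tendsto_zero_of_le_half_add (M := m + 1)
      (b := fun t => H * (2 * ((m + 1) * (α t * D)))) m.succ_pos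
      (fun t => Finset.sum_nonneg fun k _ => norm_nonneg _) ?_ fun τ => ?_
    · simpa using
        (((hαzero.mul_const D).const_mul ((m : ℝ) + 1)).const_mul 2).const_mul (H : ℝ)
    · have hsum := Finset.sum_le_sum fun k (_ : k ∈ Finset.univ) => hpair τ k
      rw [Finset.sum_const, Finset.card_univ, Fintype.card_fin, nsmul_eq_mul] at hsum
      have hS : 0 ≤ ∑ l, ‖x τ l - x τ i‖ := Finset.sum_nonneg fun k _ => norm_nonneg _
      have hcontr := mul_le_mul_of_nonneg_right hm.le hS
      rw [← add_assoc]
      linarith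
  refine squeeze_zero (fun t => norm_nonneg _) (fun t => ?_) hspread
  rw [norm_sub_rev]
  exact Finset.single_le_sum (f := fun k => ‖x t k - x t i‖) (fun k _ => norm_nonneg _)
    (Finset.mem_univ j)
end

section
/- Let H ≥ 1, d ≥ 1, D ≥ 0, T ≥ 1, and let f_1,…,f_H : ℝ^d → ℝ be convex functions, and for each i let g_i : ℝ^d → ℝ^d satisfy: for every x, g_i(x) is a subgradient of f_i at x and ‖g_i(x)‖ ≤ D. Consider the dynamics v_i(t) = Σ_{j=1}^H [W(t)]_{ij} x_j(t), x_i(t+1) = v_i(t) − α(t) g_i(v_i(t)) with fixed stepsize α(t) = 1/√T for t ∈ {0,1,…,T−1}, where each W(t) is an H×H row-stochastic matrix, {π(t)} is a sequence of stochastic vectors with π(t)ᵀ = π(t+1)ᵀ W(t) for all t, and there is λ ∈ (0,1) such that |[W(t)W(t−1)⋯W(τ)]_{ij} − π_j(τ)| ≤ 2λ^{t−τ} for all t ≥ τ ≥ 0 and all i,j. Suppose there exist a nonempty set X* ⊆ ℝ^d, a subset S ⊆ {1,…,H}, and p > 0 such that: π_i(t) ≥ p for all i ∈ S and all t; X* =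 argmin_x Σ_{i∈S} f_i(x); and X* ⊆ argmin_x f_i(x) for every i ∈ {1,…,H}. Then for every agent j ∈ {1,…,H} and every z ∈ X*, Σ_{i∈S} f_i( (1/T) Σ_{τ=0}^{T−1} x_j(τ) ) − Σ_{i∈S} f_i(z) ≤ C/√T, where C = (1/(2p)) ( Σ_{i=1}^H π_i(0)‖x_i(0) − z‖² + D² + (4D(H+1)/(1−λ)) Σ_{i=1}^H ‖x_i(0)‖ + 8D²H(H+1)/(λ(1−λ)²) + 4D²H(H+1)/(1−λ) + 4D²(H+1) ); in particular the optimality gap is O(1/√T). -/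
open Filter RealInnerProductSpace

section ConsensusDynamics

variable {H : ℕ} {E : Type*}

lemma sum_mul_smul_eq [AddCommGroup E] [Module ℝ E] (M N : Matrix (Fin H) (Fin H) ℝ)
    (z : Fin H → E) (i : Fin H) :
    ∑ j, M i j • ∑ k, N j k • z k = ∑ k, (M * N) i k • z k := by
  simp only [Matrix.mul_apply, Finset.smul_sum, Finset.sum_smul, smul_smul]
  exact Finset.sum_comm

/-- Unrolled form of a perturbed linear consensus recursion. -/
lemma mixed_state_eq [AddCommGroup E] [Module ℝ E] (W : ℕ → Matrix (Fin H) (Fin H) ℝ) (a : ℝ)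
    (x u : ℕ → Fin H → E) (t : ℕ)
    (hdyn : ∀ s < t, ∀ i, x (s + 1) i = (∑ j, W s i j • x s j) - a • u s i) (i : Fin H) :
    ∑ j, W t i j • x t j = (∑ k, backProd H W 0 t i k • x 0 k)
      - a • ∑ s ∈ Finset.range t, ∑ k, backProd H W (s + 1) (t - 1 - s) i k • u s k := by
  induction t generalizing i with
  | zero => simp [backProd]
  | succ t ih =>
    have ih' := ih fun s hs => hdyn s (by omega)
    have hlast : ∀ s ∈ Finset.range t,
        ∑ k, backProd H W (s + 1) (t + 1 - 1 - s) i k • u s k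
          = ∑ j, W (t + 1) i j • ∑ k, backProd H W (s + 1) (t - 1 - s) j k • u s k := by
      intro s hs
      have hs := Finset.mem_range.mp hs
      obtain ⟨m, rfl⟩ : ∃ m, t = s + 1 + m := ⟨t - (s + 1), by omega⟩
      have h1 : s + 1 + m + 1 - 1 - s = m + 1 := by omega
      have h2 : s + 1 + m - 1 - s = m := by omega
      rw [sum_mul_smul_eq, h1, h2, backProd]
    have hzero : ∑ k, backProd H W 0 (t + 1) i k • x 0 k
        = ∑ j, W (t + 1) i j • ∑ k, backProd H W 0 t j k • x 0 k := by
      rw [sum_mul_smul_eq, backProd, zero_add]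
    rw [Finset.sum_range_succ, Finset.sum_congr rfl hlast, hzero]
    simp only [hdyn t (Nat.lt_succ_self t), ih', smul_sub, Finset.sum_sub_distrib, smul_add,
      Nat.add_sub_cancel, Nat.sub_self, backProd]
    rw [Finset.sum_comm (s := Finset.range t)]
    simp only [← Finset.smul_sum, smul_comm _ a]
    abel

lemma sum_stationary_smul_mixed [AddCommGroup E] [Module ℝ E] (M : Matrix (Fin H) (Fin H) ℝ)
    (q r : Fin H → ℝ) (h : ∀ j, q j = ∑ i, r i * M i j) (z : Fin H → E) :
    ∑ i, r i • ∑ j, M i j • z j = ∑ j, q j • z j := by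
  simp only [h, Finset.smul_sum, Finset.sum_smul, smul_smul]
  exact Finset.sum_comm

lemma weighted_average_succ [AddCommGroup E] [Module ℝ E] (W : ℕ → Matrix (Fin H) (Fin H) ℝ)
    (a : ℝ) (x u : ℕ → Fin H → E) (π : ℕ → Fin H → ℝ)
    (hπ : ∀ t j, π t j = ∑ i, π (t + 1) i * W t i j) (t : ℕ)
    (hdyn : ∀ i, x (t + 1) i = (∑ j, W t i j • x t j) - a • u t i) :
    ∑ i, π (t + 1) i • x (t + 1) i
      = (∑ i, π t i • x t i) - a • ∑ i, π (t + 1) i • u t i := by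
  simp only [hdyn, smul_sub, Finset.sum_sub_distrib, smul_comm _ a, ← Finset.smul_sum]
  rw [sum_stationary_smul_mixed (W t) (π t) (π (t + 1)) (hπ t)]

lemma weighted_average_eq [AddCommGroup E] [Module ℝ E] (W : ℕ → Matrix (Fin H) (Fin H) ℝ)
    (a : ℝ) (x u : ℕ → Fin H → E) (π : ℕ → Fin H → ℝ)
    (hπ : ∀ t j, π t j = ∑ i, π (t + 1) i * W t i j) (t : ℕ)
    (hdyn : ∀ s < t, ∀ i, x (s + 1) i = (∑ j, W s i j • x s j) - a • u s i) :
    ∑ i, π t i • x t i = (∑ i, π 0 i • x 0 i)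
      - a • ∑ s ∈ Finset.range t, ∑ k, π (s + 1) k • u s k := by
  induction t with
  | zero => simp
  | succ t ih =>
    rw [weighted_average_succ W a x u π hπ t (hdyn t (Nat.lt_succ_self t)),
      ih fun s hs => hdyn s (by omega), Finset.sum_range_succ, smul_add]
    abel

variable [NormedAddCommGroup E]

lemma norm_sum_smul_sub_le [NormedSpace ℝ E] (w q : Fin H → ℝ) (c : ℝ)
    (h : ∀ k, |w k - q k| ≤ c) (z : Fin H → E) :
    ‖(∑ k, w k • z k) - ∑ k, q k • z k‖ ≤ c * ∑ k, ‖z k‖ := by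
  rw [← Finset.sum_sub_distrib, Finset.mul_sum]
  refine (norm_sum_le _ _).trans (Finset.sum_le_sum fun k _ => ?_)
  rw [← sub_smul, norm_smul, Real.norm_eq_abs]
  exact mul_le_mul_of_nonneg_right (h k) (norm_nonneg _)

lemma norm_sum_smul_le_of_stochastic [NormedSpace ℝ E] (w : Fin H → ℝ) (hw : ∀ k, 0 ≤ w k)
    (hsum : ∑ k, w k = 1) (z : Fin H → E) (c : ℝ) (hz : ∀ k, ‖z k‖ ≤ c) :
    ‖∑ k, w k • z k‖ ≤ c := by
  calc ‖∑ k, w k • z k‖ ≤ ∑ k, w k * c := by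
        refine (norm_sum_le _ _).trans (Finset.sum_le_sum fun k _ => ?_)
        rw [norm_smul, Real.norm_of_nonneg (hw k)]
        exact mul_le_mul_of_nonneg_left (hz k) (hw k)
    _ = c := by rw [← Finset.sum_mul, hsum, one_mul]

lemma geom_sum_range_le {lam : ℝ} (h0 : 0 ≤ lam) (h1 : lam < 1) (n : ℕ) :
    ∑ s ∈ Finset.range n, lam ^ s ≤ 1 / (1 - lam) := by
  have h := (summable_geometric_of_lt_one h0 h1).sum_le_tsum (Finset.range n)
    fun s _ => pow_nonneg h0 s
  rwa [tsum_geometric_of_lt_one h0 h1, ← one_div] at h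

/-- Geometric consensus: mixed states stay close to the weighted average. -/
lemma norm_mixed_sub_average_le [NormedSpace ℝ E] (W : ℕ → Matrix (Fin H) (Fin H) ℝ) (a D lam : ℝ)
    (ha : 0 ≤ a) (h0 : 0 ≤ lam) (h1 : lam < 1) (hD : 0 ≤ D)
    (x u : ℕ → Fin H → E) (π : ℕ → Fin H → ℝ) (hu : ∀ t i, ‖u t i‖ ≤ D)
    (hπ : ∀ t j, π t j = ∑ i, π (t + 1) i * W t i j)
    (hΦ : ∀ τ m i j, |backProd H W τ m i j - π τ j| ≤ 2 * lam ^ m) (t : ℕ)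
    (hdyn : ∀ s < t, ∀ i, x (s + 1) i = (∑ j, W s i j • x s j) - a • u s i) (i : Fin H) :
    ‖(∑ j, W t i j • x t j) - ∑ j, π t j • x t j‖
      ≤ 2 * lam ^ t * (∑ k, ‖x 0 k‖) + a * (2 * D * H / (1 - lam)) := by
  rw [mixed_state_eq W a x u t hdyn i, weighted_average_eq W a x u π hπ t hdyn,
    sub_sub_sub_comm, ← smul_sub, ← Finset.sum_sub_distrib (s := Finset.range t)]
  refine (norm_sub_le _ _).trans (add_le_add (norm_sum_smul_sub_le _ _ _ (hΦ 0 t i) _) ?_)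
  rw [norm_smul, Real.norm_of_nonneg ha]
  refine mul_le_mul_of_nonneg_left ?_ ha
  have hterm : ∀ s ∈ Finset.range t,
      ‖(∑ k, backProd H W (s + 1) (t - 1 - s) i k • u s k) - ∑ k, π (s + 1) k • u s k‖
        ≤ 2 * D * H * lam ^ (t - 1 - s) := by
    intro s _
    refine (norm_sum_smul_sub_le _ _ _ (hΦ (s + 1) (t - 1 - s) i) _).trans ?_
    have hsum : ∑ k, ‖u s k‖ ≤ H * D := by
      simpa using Finset.sum_le_sum fun k (_ : k ∈ Finset.univ) => hu s k
    calc 2 * lam ^ (t - 1 - s) * ∑ k, ‖u s k‖ ≤ 2 * lam ^ (t - 1 - s) * (H * D) := by gcongr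
      _ = _ := by ring
  refine (norm_sum_le _ _).trans ((Finset.sum_le_sum hterm).trans ?_)
  rw [← Finset.mul_sum, Finset.sum_range_reflect (fun s => lam ^ s) t, div_eq_mul_one_div]
  exact mul_le_mul_of_nonneg_left (geom_sum_range_le h0 h1 t) (by positivity)

/-- Every mixed state stays close to every agent's current state. -/
lemma norm_mixed_sub_state_succ_le [NormedSpace ℝ E] (W : ℕ → Matrix (Fin H) (Fin H) ℝ)
    (a D lam : ℝ) (ha : 0 ≤ a) (h0 : 0 ≤ lam) (h1 : lam < 1) (hD : 0 ≤ D)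
    (x u : ℕ → Fin H → E) (π : ℕ → Fin H → ℝ) (hu : ∀ t i, ‖u t i‖ ≤ D)
    (hπ0 : ∀ t i, 0 ≤ π t i) (hπ1 : ∀ t, ∑ i, π t i = 1)
    (hπ : ∀ t j, π t j = ∑ i, π (t + 1) i * W t i j)
    (hΦ : ∀ τ m i j, |backProd H W τ m i j - π τ j| ≤ 2 * lam ^ m) (t : ℕ)
    (hdyn : ∀ s < t + 1, ∀ i, x (s + 1) i = (∑ j, W s i j • x s j) - a • u s i)
    (i j : Fin H) :
    ‖(∑ k, W (t + 1) i k • x (t + 1) k) - x (t + 1) j‖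
      ≤ 2 * (∑ k, ‖x 0 k‖) * (lam ^ (t + 1) + lam ^ t)
        + a * (4 * D * H / (1 - lam) + 2 * D) := by
  have hnew := norm_mixed_sub_average_le W a D lam ha h0 h1 hD x u π hu hπ hΦ (t + 1) hdyn i
  have hold := norm_mixed_sub_average_le W a D lam ha h0 h1 hD x u π hu hπ hΦ t
    (fun s hs => hdyn s (by omega)) j
  have hstep := weighted_average_succ W a x u π hπ t (hdyn t (Nat.lt_succ_self t))
  have hx := hdyn t (Nat.lt_succ_self t) j
  set ynew := ∑ k, π (t + 1) k • x (t + 1) k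
  set yold := ∑ k, π t k • x t k
  set v := ∑ k, W (t + 1) i k • x (t + 1) k
  set vold := ∑ k, W t j k • x t k
  have hG : ‖∑ k, π (t + 1) k • u t k‖ ≤ D :=
    norm_sum_smul_le_of_stochastic _ (hπ0 _) (hπ1 _) _ _ (hu t)
  set G := ∑ k, π (t + 1) k • u t k
  have hdecomp : v - x (t + 1) j = (v - ynew) - (vold - yold) - a • (G - u t j) := by
    rw [hstep, hx, smul_sub]; abel
  have hGu : ‖a • (G - u t j)‖ ≤ a * (2 * D) := by
    rw [norm_smul, Real.norm_of_nonneg ha]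
    refine mul_le_mul_of_nonneg_left ((norm_sub_le _ _).trans ?_) ha
    linarith [hu t j]
  rw [hdecomp]
  refine (norm_sub_le _ _).trans ((add_le_add_left (norm_sub_le _ _) _).trans ?_)
  refine (add_le_add (add_le_add hnew hold) hGu).trans (le_of_eq ?_)
  ring

/-- The disagreement along the trajectory, summed over the horizon. -/
lemma sum_norm_mixed_sub_state_le [NormedSpace ℝ E] (W : ℕ → Matrix (Fin H) (Fin H) ℝ)
    (a D lam : ℝ) (ha : 0 ≤ a) (h0 : 0 ≤ lam) (h1 : lam < 1) (hD : 0 ≤ D)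
    (x u : ℕ → Fin H → E) (π : ℕ → Fin H → ℝ) (hu : ∀ t i, ‖u t i‖ ≤ D)
    (hW0 : ∀ t i j, 0 ≤ W t i j) (hW1 : ∀ t i, ∑ j, W t i j = 1)
    (hπ0 : ∀ t i, 0 ≤ π t i) (hπ1 : ∀ t, ∑ i, π t i = 1)
    (hπ : ∀ t j, π t j = ∑ i, π (t + 1) i * W t i j)
    (hΦ : ∀ τ m i j, |backProd H W τ m i j - π τ j| ≤ 2 * lam ^ m) (T : ℕ) (hT : 1 ≤ T)
    (hdyn : ∀ s < T, ∀ i, x (s + 1) i = (∑ j, W s i j • x s j) - a • u s i)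
    (j : Fin H) :
    ∑ t ∈ Finset.range T, ∑ i, π (t + 1) i * ‖(∑ k, W t i k • x t k) - x t j‖
      ≤ 4 * (∑ k, ‖x 0 k‖) / (1 - lam) + T * (a * (4 * D * H / (1 - lam) + 2 * D)) := by
  obtain ⟨n, rfl⟩ : ∃ n, T = n + 1 := ⟨T - 1, by omega⟩
  set X := ∑ k, ‖x 0 k‖
  set c := a * (4 * D * H / (1 - lam) + 2 * D)
  have hlam : 0 < 1 - lam := by linarith
  have hc0 : 0 ≤ c := by positivity
  have hX0 : 0 ≤ X := Finset.sum_nonneg fun _ _ => norm_nonneg _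
  have havg : ∀ t b, (∀ i, ‖(∑ k, W t i k • x t k) - x t j‖ ≤ b) →
      ∑ i, π (t + 1) i * ‖(∑ k, W t i k • x t k) - x t j‖ ≤ b := by
    intro t b hb
    calc _ ≤ ∑ i, π (t + 1) i * b :=
          Finset.sum_le_sum fun i _ => mul_le_mul_of_nonneg_left (hb i) (hπ0 _ i)
      _ = b := by rw [← Finset.sum_mul, hπ1, one_mul]
  have hinit : ∀ k, ‖x 0 k‖ ≤ X := fun k =>
    Finset.single_le_sum (f := fun k => ‖x 0 k‖) (fun _ _ => norm_nonneg _) (Finset.mem_univ k)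
  have hfirst := havg 0 (2 * X) fun i => by
    refine (norm_sub_le _ _).trans ?_
    linarith [hinit j, norm_sum_smul_le_of_stochastic _ (hW0 0 i) (hW1 0 i) _ _ hinit]
  have hrest : ∑ t ∈ Finset.range n,
        ∑ i, π (t + 1 + 1) i * ‖(∑ k, W (t + 1) i k • x (t + 1) k) - x (t + 1) j‖
      ≤ ∑ t ∈ Finset.range n, (2 * X * (lam ^ (t + 1) + lam ^ t) + c) := by
    refine Finset.sum_le_sum fun t ht => havg (t + 1) _ fun i => ?_
    have ht := Finset.mem_range.mp ht
    exact norm_mixed_sub_state_succ_le W a D lam ha h0 h1 hD x u π hu hπ0 hπ1 hπ hΦ t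
      (fun s hs => hdyn s (by omega)) i j
  have hgeom : 2 * X + ∑ t ∈ Finset.range n, (2 * X * (lam ^ (t + 1) + lam ^ t) + c)
      = 2 * X * (∑ t ∈ Finset.range (n + 1), lam ^ t + ∑ t ∈ Finset.range n, lam ^ t)
        + n * c := by
    rw [Finset.sum_range_succ', Finset.sum_add_distrib, ← Finset.mul_sum,
      Finset.sum_add_distrib]
    simp
    ring
  have hbound := mul_le_mul_of_nonneg_left
    (add_le_add (geom_sum_range_le h0 h1 (n + 1)) (geom_sum_range_le h0 h1 n))
    (mul_nonneg zero_le_two hX0)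
  have hsplit : 2 * X * (1 / (1 - lam) + 1 / (1 - lam)) = 4 * X / (1 - lam) := by ring
  rw [Finset.sum_range_succ']
  push_cast
  linarith

end ConsensusDynamics

section SubgradientDescent

variable {H : ℕ} {E : Type*} [NormedAddCommGroup E] [InnerProductSpace ℝ E]

lemma sq_norm_sum_smul_sub_le (w : Fin H → ℝ) (hw : ∀ k, 0 ≤ w k) (hsum : ∑ k, w k = 1)
    (y : Fin H → E) (z : E) : ‖(∑ k, w k • y k) - z‖ ^ 2 ≤ ∑ k, w k * ‖y k - z‖ ^ 2 := by
  have hconv : ConvexOn ℝ Set.univ fun y : E => ‖y‖ ^ 2 :=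
    convexOn_univ_norm.pow (fun _ _ => norm_nonneg _) 2
  have h := hconv.map_sum_le (t := Finset.univ) (w := w) (p := fun k => y k - z)
    (fun k _ => hw k) hsum (fun _ _ => Set.mem_univ _)
  simpa [smul_sub, Finset.sum_sub_distrib, ← Finset.sum_smul, hsum] using h

lemma sq_norm_subgradient_step_le (φ : E → ℝ) (v z γ : E) (a D : ℝ) (ha : 0 ≤ a)
    (hsub : φ v + ⟪γ, z - v⟫ ≤ φ z) (hγ : ‖γ‖ ≤ D) :
    ‖v - a • γ - z‖ ^ 2 ≤ ‖v - z‖ ^ 2 - 2 * a * (φ v - φ z) + a ^ 2 * D ^ 2 := by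
  have hexp : ‖v - a • γ - z‖ ^ 2
      = ‖v - z‖ ^ 2 + 2 * a * ⟪γ, z - v⟫ + a ^ 2 * ‖γ‖ ^ 2 := by
    have hre : v - a • γ - z = (v - z) - a • γ := by abel
    rw [hre, norm_sub_sq_real, inner_smul_right, real_inner_comm, norm_smul, mul_pow,
      Real.norm_eq_abs, sq_abs, ← neg_sub z v, inner_neg_right, norm_neg]
    ring
  rw [hexp]
  nlinarith [mul_le_mul_of_nonneg_left hsub ha,
    mul_le_mul_of_nonneg_left (pow_le_pow_left₀ (norm_nonneg γ) hγ 2) (sq_nonneg a)]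

/-- One-step descent of the weighted squared distance to a point. -/
lemma weighted_sq_dist_succ_le (M : Matrix (Fin H) (Fin H) ℝ) (hM0 : ∀ i j, 0 ≤ M i j)
    (hM1 : ∀ i, ∑ j, M i j = 1) (q r : Fin H → ℝ) (hr : ∀ i, 0 ≤ r i) (hr1 : ∑ i, r i = 1)
    (hqr : ∀ j, q j = ∑ i, r i * M i j) (f : Fin H → E → ℝ) (g : Fin H → E → E)
    (hsub : ∀ i x y, f i x + ⟪g i x, y - x⟫ ≤ f i y) (a D : ℝ) (ha : 0 ≤ a)
    (hg : ∀ i x, ‖g i x‖ ≤ D) (x x' : Fin H → E) (z : E)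
    (hdyn : ∀ i, x' i = (∑ j, M i j • x j) - a • g i (∑ j, M i j • x j)) :
    (∑ i, r i * ‖x' i - z‖ ^ 2) + 2 * a * ∑ i, r i * (f i (∑ j, M i j • x j) - f i z)
      ≤ (∑ i, q i * ‖x i - z‖ ^ 2) + a ^ 2 * D ^ 2 := by
  have hmix : ∑ i, r i * ∑ j, M i j * ‖x j - z‖ ^ 2 = ∑ j, q j * ‖x j - z‖ ^ 2 :=
    sum_stationary_smul_mixed M q r hqr fun j => ‖x j - z‖ ^ 2
  have hconst : a ^ 2 * D ^ 2 = ∑ i, r i * (a ^ 2 * D ^ 2) := by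
    rw [← Finset.sum_mul, hr1, one_mul]
  rw [← hmix, hconst, Finset.mul_sum, ← Finset.sum_add_distrib, ← Finset.sum_add_distrib]
  refine Finset.sum_le_sum fun i _ => ?_
  have h1 := sq_norm_subgradient_step_le (f i) (∑ j, M i j • x j) z
    (g i (∑ j, M i j • x j)) a D ha (hsub i _ z) (hg i _)
  rw [← hdyn] at h1
  have h2 := sq_norm_sum_smul_sub_le (M i) (hM0 i) (hM1 i) x z
  nlinarith [mul_le_mul_of_nonneg_left (h1.trans (add_le_add_left (sub_le_sub_right h2 _) _)) (hr i)]

/-- Weighted optimality gaps at several points control the gap at a common point. -/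
lemma gap_le_weighted_gap_add (f : Fin H → E → ℝ) (g : Fin H → E → E)
    (hsub : ∀ i x y, f i x + ⟪g i x, y - x⟫ ≤ f i y) (D : ℝ) (hg : ∀ i x, ‖g i x‖ ≤ D)
    (r : Fin H → ℝ) (hr : ∀ i, 0 ≤ r i) (S : Finset (Fin H)) (p : ℝ)
    (hrS : ∀ i ∈ S, p ≤ r i) (v : Fin H → E) (w z : E) (hz : ∀ i y, f i z ≤ f i y) :
    p * ∑ i ∈ S, (f i w - f i z)
      ≤ (∑ i, r i * (f i (v i) - f i z)) + D * ∑ i, r i * ‖v i - w‖ := by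
  calc p * ∑ i ∈ S, (f i w - f i z) ≤ ∑ i ∈ S, r i * (f i w - f i z) := by
        rw [Finset.mul_sum]
        exact Finset.sum_le_sum fun i hi =>
          mul_le_mul_of_nonneg_right (hrS i hi) (sub_nonneg.mpr (hz i w))
    _ ≤ ∑ i, r i * (f i w - f i z) :=
        Finset.sum_le_univ_sum_of_nonneg fun i => mul_nonneg (hr i) (sub_nonneg.mpr (hz i w))
    _ ≤ _ := by
        rw [Finset.mul_sum, ← Finset.sum_add_distrib]
        refine Finset.sum_le_sum fun i _ => ?_
        have hcs : -(D * ‖v i - w‖) ≤ ⟪g i w, v i - w⟫ :=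
          (neg_le_neg (mul_le_mul_of_nonneg_right (hg i w) (norm_nonneg _))).trans
            (neg_le_of_abs_le (abs_real_inner_le_norm _ _))
        nlinarith [mul_le_mul_of_nonneg_left (hsub i w (v i)) (hr i),
          mul_le_mul_of_nonneg_left hcs (hr i)]

/-- Jensen's inequality for the uniform average of a trajectory. -/
lemma sum_map_average_sub_le (f : Fin H → E → ℝ) (hf : ∀ i, ConvexOn ℝ Set.univ (f i))
    (S : Finset (Fin H)) (T : ℕ) (hT : 1 ≤ T) (y : ℕ → E) (z : E) :
    (∑ i ∈ S, f i ((T : ℝ)⁻¹ • ∑ τ ∈ Finset.range T, y τ)) - ∑ i ∈ S, f i z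
      ≤ (T : ℝ)⁻¹ * ∑ τ ∈ Finset.range T, ∑ i ∈ S, (f i (y τ) - f i z) := by
  have hT0 : (T : ℝ) ≠ 0 := by positivity
  rw [Finset.sum_comm, Finset.mul_sum, ← Finset.sum_sub_distrib]
  refine Finset.sum_le_sum fun i _ => ?_
  have h := (hf i).map_sum_le (t := Finset.range T) (w := fun _ => (T : ℝ)⁻¹) (p := y)
    (fun _ _ => by positivity) (by simp [hT0]) (fun _ _ => Set.mem_univ _)
  simp only [smul_eq_mul, ← Finset.smul_sum, ← Finset.mul_sum] at h
  rw [Finset.sum_sub_distrib, mul_sub]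
  simp only [Finset.sum_const, Finset.card_range, nsmul_eq_mul, inv_mul_cancel_left₀ hT0]
  linarith

end SubgradientDescent

theorem stmt18 (H d T : ℕ) (hH : 1 ≤ H) (hd : 1 ≤ d) (hT : 1 ≤ T) (D : ℝ) (hD : 0 ≤ D)
    (f : Fin H → EuclideanSpace ℝ (Fin d) → ℝ)
    (g : Fin H → EuclideanSpace ℝ (Fin d) → EuclideanSpace ℝ (Fin d))
    (hconv : ∀ i, ConvexOn ℝ Set.univ (f i))
    (hsubgrad : ∀ i x y, f i x + ⟪g i x, y - x⟫ ≤ f i y)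
    (hgbound : ∀ i x, ‖g i x‖ ≤ D)
    (lam : ℝ) (hlam0 : 0 < lam) (hlam1 : lam < 1)
    (W : ℕ → Matrix (Fin H) (Fin H) ℝ)
    (x : ℕ → Fin H → EuclideanSpace ℝ (Fin d))
    (pivec : ℕ → Fin H → ℝ)
    (hWnonneg : ∀ t i j, 0 ≤ W t i j)
    (hWrow : ∀ t i, ∑ j, W t i j = 1)
    (hdyn : ∀ t < T, ∀ i, x (t + 1) i =
      (∑ j, W t i j • x t j)
        - (1 / Real.sqrt T) • g i (∑ j, W t i j • x t j))
    (hpinonneg : ∀ t i, 0 ≤ pivec t i)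
    (hpisum : ∀ t, ∑ i, pivec t i = 1)
    (hpiaps : ∀ t j, pivec t j = ∑ i, pivec (t + 1) i * W t i j)
    (hPhi : ∀ τ m i j, |backProd H W τ m i j - pivec τ j| ≤ 2 * lam ^ m)
    (Xstar : Set (EuclideanSpace ℝ (Fin d))) (hXne : Xstar.Nonempty)
    (S : Finset (Fin H)) (p : ℝ) (hp : 0 < p)
    (hpiS : ∀ i ∈ S, ∀ t, p ≤ pivec t i)
    (hXargmin : Xstar = argminSet (fun z => ∑ i ∈ S, f i z))
    (hXopt : ∀ i : Fin H, Xstar ⊆ argminSet (f i)) :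
    ∀ j : Fin H, ∀ z ∈ Xstar,
      (∑ i ∈ S, f i (((T : ℝ))⁻¹ • ∑ τ ∈ Finset.range T, x τ j)) - ∑ i ∈ S, f i z ≤
        ((1 / (2 * p)) *
          ((∑ i, pivec 0 i * ‖x 0 i - z‖ ^ 2) + D ^ 2
            + (4 * D * (H + 1) / (1 - lam)) * ∑ i, ‖x 0 i‖
            + 8 * D ^ 2 * H * (H + 1) / (lam * (1 - lam) ^ 2)
            + 4 * D ^ 2 * H * (H + 1) / (1 - lam)
            + 4 * D ^ 2 * (H + 1))) / Real.sqrt T := by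
  intro j z hz
  have hTpos : (0 : ℝ) < T := by exact_mod_cast hT
  have hT1 : (1 : ℝ) ≤ T := by exact_mod_cast hT
  have hH1 : (1 : ℝ) ≤ H := by exact_mod_cast hH
  have hsqrt : 1 ≤ Real.sqrt T := Real.one_le_sqrt.mpr hT1
  have hsq : Real.sqrt T * Real.sqrt T = T := Real.mul_self_sqrt hTpos.le
  set a := 1 / Real.sqrt T with ha_def
  have ha0 : 0 < a := by positivity
  have ha1 : a ≤ 1 := (div_le_one (by positivity)).mpr hsqrt
  have haT : T * (a * a) = 1 := by
    rw [ha_def, div_mul_div_comm, hsq]; field_simp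
  have hlam : 0 < 1 - lam := by linarith
  set X := ∑ k, ‖x 0 k‖
  have hX0 : 0 ≤ X := Finset.sum_nonneg fun _ _ => norm_nonneg _
  set V := ∑ i, pivec 0 i * ‖x 0 i - z‖ ^ 2
  have hdisagree := sum_norm_mixed_sub_state_le W a D lam ha0.le hlam0.le hlam1 hD x
    (fun t i => g i (∑ j, W t i j • x t j)) pivec (fun _ i => hgbound i _) hWnonneg hWrow
    hpinonneg hpisum hpiaps hPhi T hT hdyn j
  have hdescent : ∀ n ≤ T, (∑ i, pivec n i * ‖x n i - z‖ ^ 2) + 2 * a * ∑ t ∈ Finset.range n,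
      ∑ i, pivec (t + 1) i * (f i (∑ j, W t i j • x t j) - f i z)
        ≤ V + n * (a ^ 2 * D ^ 2) := by
    intro n
    induction n with
    | zero => simp [V]
    | succ n ih =>
      intro hn
      have hstep := weighted_sq_dist_succ_le (W n) (hWnonneg n) (hWrow n) (pivec n)
        (pivec (n + 1)) (hpinonneg _) (hpisum _) (hpiaps n) f g hsubgrad a D ha0.le hgbound
        (x n) (x (n + 1)) z (hdyn n (by omega))
      rw [Finset.sum_range_succ, mul_add]
      push_cast
      linarith [ih (by omega)]
  have hgap := Finset.sum_le_sum fun t (_ : t ∈ Finset.range T) =>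
    gap_le_weighted_gap_add f g hsubgrad D hgbound (pivec (t + 1)) (hpinonneg _) S p
      (fun i hi => hpiS i hi _) (fun i => ∑ j, W t i j • x t j) (x t j) z
      fun i => hXopt i hz
  rw [← Finset.mul_sum, Finset.sum_add_distrib, ← Finset.mul_sum] at hgap
  have hfinal : 0 ≤ ∑ i, pivec T i * ‖x T i - z‖ ^ 2 :=
    Finset.sum_nonneg fun i _ => mul_nonneg (hpinonneg _ i) (sq_nonneg _)
  have hdesc := hdescent T le_rfl
  set Q := ∑ τ ∈ Finset.range T, ∑ i ∈ S, (f i (x τ j) - f i z)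
  set Δ := ∑ t ∈ Finset.range T,
    ∑ i, pivec (t + 1) i * ‖(∑ k, W t i k • x t k) - x t j‖
  set K := V + D ^ 2 + 4 * D * (H + 1) / (1 - lam) * X
    + 8 * D ^ 2 * H * (H + 1) / (lam * (1 - lam) ^ 2)
    + 4 * D ^ 2 * H * (H + 1) / (1 - lam) + 4 * D ^ 2 * (H + 1)
  have hΔ : 2 * a * D * Δ ≤ 4 * D * (H + 1) / (1 - lam) * X
      + 8 * D ^ 2 * H * (H + 1) / (lam * (1 - lam) ^ 2) + 4 * D ^ 2 * (H + 1) := by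
    have hX' : a * (8 * D * X / (1 - lam)) ≤ 4 * D * (H + 1) / (1 - lam) * X := by
      calc a * (8 * D * X / (1 - lam)) ≤ 1 * (8 * D * X / (1 - lam)) := by gcongr
        _ = 4 * D * (1 + 1) / (1 - lam) * X := by ring
        _ ≤ _ := by gcongr
    have hgeom : 8 * D ^ 2 * H / (1 - lam)
        ≤ 8 * D ^ 2 * H * (H + 1) / (lam * (1 - lam) ^ 2) := by
      have hden : lam * (1 - lam) ^ 2 ≤ 1 - lam := by nlinarith [mul_pos hlam0 hlam]
      have hnum : 8 * D ^ 2 * H ≤ 8 * D ^ 2 * H * (H + 1) :=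
        le_mul_of_one_le_right (by positivity) (by linarith)
      exact div_le_div₀ (by positivity) hnum (by positivity) hden
    have hlast : 4 * D ^ 2 ≤ 4 * D ^ 2 * (H + 1) :=
      le_mul_of_one_le_right (by positivity) (by linarith)
    calc 2 * a * D * Δ ≤ 2 * a * D
          * (4 * X / (1 - lam) + T * (a * (4 * D * H / (1 - lam) + 2 * D))) := by gcongr
      _ = a * (8 * D * X / (1 - lam))
          + T * (a * a) * (8 * D ^ 2 * H / (1 - lam) + 4 * D ^ 2) := by ring
      _ ≤ _ := by rw [haT]; linarith
  have hextra : 0 ≤ 4 * D ^ 2 * H * (H + 1) / (1 - lam) := by positivity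
  have hQ : 2 * a * p * Q ≤ K := by
    have hnoise : T * (a ^ 2 * D ^ 2) = D ^ 2 := by
      rw [pow_two a, ← mul_assoc, haT, one_mul]
    have := mul_le_mul_of_nonneg_left hgap (by positivity : 0 ≤ 2 * a)
    linarith
  refine (sum_map_average_sub_le f hconv S T hT (fun τ => x τ j) z).trans ?_
  change (T : ℝ)⁻¹ * Q ≤ 1 / (2 * p) * K / Real.sqrt T
  calc (T : ℝ)⁻¹ * Q = 2 * a * p * Q / (2 * p) / Real.sqrt T := by
        rw [inv_eq_of_mul_eq_one_right haT, div_eq_mul_one_div _ (Real.sqrt T), ← ha_def]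
        field_simp
    _ ≤ K / (2 * p) / Real.sqrt T := by gcongr
    _ = _ := by ring
end
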